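/- Let d ≥ 2 and let (n₁, …, n_d) ∈ ℕ^d with k = n₁ + ⋯ + n_d, and assume that k ≥ 1 or d ≥ 3. Then there exist constants C = C(n₁,…,n_d,d) > 0 and r₀ > 0, depending only on n₁,…,n_d and d, such that for every continuous function w = (w₁,…,w_d) : [0,1] → ℝ^d and every u = (u₁,…,u_d) ∈ ℝ^d with 0 < ‖u‖ ≤ r₀: |∫_{Δ₂} ∏_{j=1}^d H_{n_j}((w_j(t)−w_j(s))/√(t−s)) · H_{n_j}(u_j/√(t−s)) · p^d_{t−s}(u) ds dt| ≤ C exp(2 Z₁ + ⋯ + 2 Z_d) / ‖u‖^{k+d−2}, where Z_i = max_{0≤s≤1} |w_i(s)|. -/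

import Mathlib

open MeasureTheory Real

/-- The `d`-dimensional Gaussian density with variance parameter `ε`. -/
noncomputable def gaussD (d : ℕ) (ε : ℝ) (z : EuclideanSpace ℝ (Fin d)) : ℝ :=
  (2 * Real.pi * ε) ^ (-(d : ℝ) / 2) * Real.exp (-‖z‖ ^ 2 / (2 * ε))

/-- The simplex `Δ₂ = {(s,t) ∈ [0,1]² : s < t}`. -/
def Delta2 : Set (ℝ × ℝ) := {p | 0 ≤ p.1 ∧ p.1 < p.2 ∧ p.2 ≤ 1}

/-- The probabilist's Hermite polynomial `H_n`, evaluated at a real number. -/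
noncomputable def H (n : ℕ) (x : ℝ) : ℝ := Polynomial.aeval x (Polynomial.hermite n)

/-- Polynomials are dominated by a quadratic exponential, with an explicit constant. -/
lemma one_add_pow_le_exp_sq (m : ℕ) {y : ℝ} (hy : 0 ≤ y) :
    (1 + y) ^ m ≤ m.factorial * Real.exp 2 * Real.exp (y ^ 2 / 4) := by
  have h1 := Real.pow_div_factorial_le_exp (1 + y) (by positivity) m
  rw [div_le_iff₀ (by positivity)] at h1
  calc (1 + y) ^ m ≤ Real.exp (1 + y) * m.factorial := h1
    _ ≤ Real.exp (2 + y ^ 2 / 4) * m.factorial := by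
        have : 1 + y ≤ 2 + y ^ 2 / 4 := by nlinarith [sq_nonneg (y - 2)]
        gcongr ?_ * _
        exact Real.exp_le_exp.mpr this
    _ = _ := by rw [Real.exp_add]; ring

lemma one_add_pow_le_exp (m : ℕ) {y : ℝ} (hy : 0 ≤ y) :
    (1 + y) ^ m ≤ m.factorial * Real.exp 1 * Real.exp y := by
  have h1 := Real.pow_div_factorial_le_exp (1 + y) (by positivity) m
  rw [div_le_iff₀ (by positivity)] at h1
  calc (1 + y) ^ m ≤ Real.exp (1 + y) * m.factorial := h1
    _ = _ := by rw [Real.exp_add]; ring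

/-- The Hermite polynomial of degree `n` grows at most like `(1 + |y|) ^ n`. -/
lemma exists_abs_H_le (n : ℕ) : ∃ A > (0 : ℝ), ∀ y : ℝ, |H n y| ≤ A * (1 + |y|) ^ n := by
  refine ⟨1 + ∑ i ∈ Finset.range (n + 1), |((Polynomial.hermite n).coeff i : ℝ)|,
    by positivity, fun y => ?_⟩
  have hH : H n y = ∑ i ∈ Finset.range (n + 1), ((Polynomial.hermite n).coeff i : ℝ) * y ^ i := by
    rw [H, Polynomial.aeval_eq_sum_range, Polynomial.natDegree_hermite]
    simp
  have hsum : |H n y| ≤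
      (∑ i ∈ Finset.range (n + 1), |((Polynomial.hermite n).coeff i : ℝ)|) * (1 + |y|) ^ n := by
    rw [hH, Finset.sum_mul]
    refine (Finset.abs_sum_le_sum_abs _ _).trans (Finset.sum_le_sum fun i hi => ?_)
    rw [abs_mul, abs_pow]
    gcongr
    calc |y| ^ i ≤ (1 + |y|) ^ i := by gcongr; linarith
      _ ≤ (1 + |y|) ^ n :=
        pow_le_pow_right₀ (by linarith [abs_nonneg y]) (Nat.lt_succ_iff.mp (Finset.mem_range.mp hi))
  have hpos : 0 ≤ (1 + |y|) ^ n := by positivity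
  linarith

/-- The product of the two Hermite factors in one coordinate, in terms of `σ = √(t - s)`. -/
lemma exists_abs_H_mul_H_le (n : ℕ) : ∃ A > (0 : ℝ), ∀ x v σ : ℝ, 0 < σ → σ ≤ 1 →
    |H n (x / σ) * H n (v / σ)| ≤
      A * (Real.exp |x| * Real.exp (v ^ 2 / (4 * σ ^ 2)) * (σ⁻¹) ^ n) := by
  obtain ⟨A, hA, hH⟩ := exists_abs_H_le n
  refine ⟨(A * (n.factorial * Real.exp 1)) * (A * (n.factorial * Real.exp 2)), by positivity,
    fun x v σ hσ hσ1 => ?_⟩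
  have h1 : |H n (x / σ)| ≤ (A * (n.factorial * Real.exp 1)) * (Real.exp |x| * (σ⁻¹) ^ n) := by
    calc |H n (x / σ)| ≤ A * (1 + |x / σ|) ^ n := hH _
      _ ≤ A * ((1 + |x|) * σ⁻¹) ^ n := by
          gcongr
          rw [abs_div, abs_of_pos hσ, add_mul, div_eq_mul_inv]
          have := (one_le_inv₀ hσ).mpr hσ1
          linarith
      _ = A * ((1 + |x|) ^ n * (σ⁻¹) ^ n) := by rw [mul_pow]
      _ ≤ A * ((n.factorial * Real.exp 1 * Real.exp |x|) * (σ⁻¹) ^ n) := by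
          gcongr
          exact one_add_pow_le_exp n (abs_nonneg x)
      _ = _ := by ring
  have h2 : |H n (v / σ)| ≤ (A * (n.factorial * Real.exp 2)) * Real.exp (v ^ 2 / (4 * σ ^ 2)) := by
    calc |H n (v / σ)| ≤ A * (1 + |v / σ|) ^ n := hH _
      _ ≤ A * (n.factorial * Real.exp 2 * Real.exp (|v / σ| ^ 2 / 4)) := by
          gcongr
          exact one_add_pow_le_exp_sq n (abs_nonneg _)
      _ = _ := by
          rw [sq_abs, div_pow, div_div, mul_comm (σ ^ 2)]
          ring
  rw [abs_mul]
  refine (mul_le_mul h1 h2 (abs_nonneg _) (by positivity)).trans_eq ?_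
  ring

lemma gaussD_le (d : ℕ) {σ : ℝ} (hσ : 0 < σ) (z : EuclideanSpace ℝ (Fin d)) :
    gaussD d (σ ^ 2) z ≤ (σ⁻¹) ^ d * Real.exp (-‖z‖ ^ 2 / (2 * σ ^ 2)) := by
  unfold gaussD
  gcongr
  have hle : σ ^ 2 ≤ 2 * Real.pi * σ ^ 2 := by
    have := Real.pi_gt_three
    nlinarith [sq_nonneg σ]
  calc (2 * Real.pi * σ ^ 2) ^ (-(d : ℝ) / 2) ≤ (σ ^ 2) ^ (-(d : ℝ) / 2) :=
        Real.rpow_le_rpow_of_nonpos (by positivity) hle (by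
          have : (0 : ℝ) ≤ d := Nat.cast_nonneg d
          linarith)
    _ = (σ⁻¹) ^ d := by
        rw [← Real.rpow_natCast σ 2, ← Real.rpow_mul hσ.le, inv_pow, ← Real.rpow_natCast σ d,
          ← Real.rpow_neg hσ.le]
        congr 1
        push_cast
        ring

/-- The heat-kernel profile `τ ^ (-m / 2) * exp (-r ^ 2 / (4 * τ))` is dominated by a rescaled
integrable profile when `3 ≤ m`; here `τ = σ ^ 2`. -/
lemma inv_pow_mul_exp_le {m : ℕ} (hm : 3 ≤ m) {r σ : ℝ} (hr : 0 < r) (hσ : 0 < σ) :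
    (σ⁻¹) ^ m * Real.exp (-r ^ 2 / (4 * σ ^ 2)) ≤
      m.factorial * Real.exp 2 * ((r ^ m)⁻¹ * (1 + ‖σ ^ 2 / r ^ 2‖) ^ (-(3 / 2) : ℝ)) := by
  have hb : (1 + σ / r) ^ (-3 : ℝ) ≤ (1 + ‖σ ^ 2 / r ^ 2‖) ^ (-(3 / 2) : ℝ) := by
    have h3 : (1 + σ / r) ^ (-3 : ℝ) = ((1 + σ / r) ^ 2) ^ (-(3 / 2) : ℝ) := by
      rw [← Real.rpow_natCast (1 + σ / r) 2, ← Real.rpow_mul (by positivity)]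
      norm_num
    rw [h3]
    refine Real.rpow_le_rpow_of_nonpos (by positivity) ?_ (by norm_num)
    rw [Real.norm_of_nonneg (by positivity), ← div_pow]
    have : 0 < σ / r := by positivity
    nlinarith
  have hc : (1 + σ / r) ^ (-3 : ℝ) = (r / σ) ^ 3 * ((1 + r / σ) ^ 3)⁻¹ := by
    rw [Real.rpow_neg (by positivity), show (3 : ℝ) = ((3 : ℕ) : ℝ) by norm_num,
      Real.rpow_natCast]
    field_simp
    ring
  have hy : 0 < r / σ := by positivity
  have key : (r / σ) ^ m * Real.exp (-(r / σ) ^ 2 / 4) ≤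
      m.factorial * Real.exp 2 * ((r / σ) ^ 3 * ((1 + r / σ) ^ 3)⁻¹) := by
    generalize r / σ = y at hy
    obtain ⟨l, rfl⟩ := Nat.exists_eq_add_of_le hm
    have h1 := one_add_pow_le_exp_sq (3 + l) hy.le
    have h2 : y ^ l * (1 + y) ^ 3 ≤ (1 + y) ^ (3 + l) := by
      rw [pow_add, mul_comm]
      gcongr
      linarith
    have h3 : y ^ l ≤ (3 + l).factorial * Real.exp 2 * Real.exp (y ^ 2 / 4) * ((1 + y) ^ 3)⁻¹ := by
      rw [← div_eq_mul_inv, le_div_iff₀ (by positivity)]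
      exact h2.trans h1
    rw [neg_div, Real.exp_neg, ← div_eq_mul_inv, div_le_iff₀ (by positivity), pow_add]
    calc y ^ 3 * y ^ l ≤
          y ^ 3 * ((3 + l).factorial * Real.exp 2 * Real.exp (y ^ 2 / 4) * ((1 + y) ^ 3)⁻¹) := by
          gcongr
      _ = _ := by ring
  calc (σ⁻¹) ^ m * Real.exp (-r ^ 2 / (4 * σ ^ 2))
      = (r ^ m)⁻¹ * ((r / σ) ^ m * Real.exp (-(r / σ) ^ 2 / 4)) := by
        rw [div_pow, div_pow, inv_pow,
          show -(r ^ 2 / σ ^ 2) / 4 = -r ^ 2 / (4 * σ ^ 2) by field_simp]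
        field_simp
    _ ≤ (r ^ m)⁻¹ * (m.factorial * Real.exp 2 * ((r / σ) ^ 3 * ((1 + r / σ) ^ 3)⁻¹)) := by
        gcongr
    _ = m.factorial * Real.exp 2 * ((r ^ m)⁻¹ * (1 + σ / r) ^ (-3 : ℝ)) := by
        rw [hc]
        ring
    _ ≤ _ := by gcongr

lemma integrable_one_add_norm_rpow :
    Integrable (fun x : ℝ => (1 + ‖x‖) ^ (-(3 / 2) : ℝ)) :=
  integrable_one_add_norm (by norm_num)

lemma measurableSet_Delta2 : MeasurableSet Delta2 :=
  (measurableSet_le measurable_const measurable_fst).inter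
    ((measurableSet_lt measurable_fst measurable_snd).inter
      (measurableSet_le measurable_snd measurable_const))

/-- A nonnegative integrable function of `t - s` is integrable over the simplex, with integral at
most that of the one-variable function. -/
lemma integrableOn_Delta2_comp_sub {G : ℝ → ℝ} (hG : Integrable G) (hG0 : ∀ x, 0 ≤ G x) :
    IntegrableOn (fun p : ℝ × ℝ => G (p.2 - p.1)) Delta2 ∧
      ∫ p in Delta2, G (p.2 - p.1) ≤ ∫ x, G x := by
  set μ : Measure ℝ := volume.restrict (Set.Icc 0 1)
  have hμ : μ.prod (volume : Measure ℝ) =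
      (volume : Measure (ℝ × ℝ)).restrict (Set.Icc 0 1 ×ˢ Set.univ) := by
    rw [Measure.volume_eq_prod, ← Measure.prod_restrict, Measure.restrict_univ]
  have hint : Integrable (fun p : ℝ × ℝ => G (p.2 - p.1)) (μ.prod volume) := by
    have h1 : Integrable (fun p : ℝ × ℝ => G p.2) (μ.prod volume) := hG.comp_snd μ
    have h2 := (measurePreserving_prod_neg_add μ (volume : Measure ℝ)).integrable_comp_of_integrable
      h1
    refine h2.congr (Filter.Eventually.of_forall fun p => ?_)
    simp [neg_add_eq_sub]
  have hval : ∫ p, G (p.2 - p.1) ∂(μ.prod volume) = ∫ x, G x := by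
    rw [integral_prod _ hint]
    simp [integral_sub_right_eq_self, μ]
  have hsub : Delta2 ⊆ Set.Icc (0 : ℝ) 1 ×ˢ Set.univ := fun p hp =>
    ⟨⟨hp.1, hp.2.1.le.trans hp.2.2⟩, trivial⟩
  rw [hμ] at hint hval
  refine ⟨IntegrableOn.mono_set hint hsub, ?_⟩
  rw [← hval]
  exact setIntegral_mono_set hint (Filter.Eventually.of_forall fun p => hG0 _) hsub.eventuallyLE

lemma abs_sub_le_two_mul_sSup {f : ℝ → ℝ} (hf : ContinuousOn f (Set.Icc 0 1)) {s t : ℝ}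
    (hs : s ∈ Set.Icc (0 : ℝ) 1) (ht : t ∈ Set.Icc (0 : ℝ) 1) :
    |f t - f s| ≤ 2 * sSup ((fun s => |f s|) '' Set.Icc 0 1) := by
  have hb : BddAbove ((fun s => |f s|) '' Set.Icc 0 1) :=
    (isCompact_Icc.image_of_continuousOn hf.abs).bddAbove
  have h1 := le_csSup hb (Set.mem_image_of_mem _ hs)
  have h2 := le_csSup hb (Set.mem_image_of_mem _ ht)
  have h3 := abs_sub (f t) (f s)
  linarith

/-- Pointwise bound of the integrand by a rescaled integrable profile. -/
lemma exists_abs_integrand_le (d : ℕ) (n : Fin d → ℕ) (hm : 3 ≤ ∑ j, n j + d) :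
    ∃ A > (0 : ℝ), ∀ x u : EuclideanSpace ℝ (Fin d), 0 < ‖u‖ → ∀ τ : ℝ, 0 < τ → τ ≤ 1 →
      |(∏ j : Fin d, H (n j) (x j / Real.sqrt τ) * H (n j) (u j / Real.sqrt τ)) * gaussD d τ u| ≤
        A * (Real.exp (∑ j, |x j|) * ((‖u‖ ^ (∑ j, n j + d))⁻¹ *
          (1 + ‖τ / ‖u‖ ^ 2‖) ^ (-(3 / 2) : ℝ))) := by
  choose A hA hH using fun j => exists_abs_H_mul_H_le (n j)
  have hA' : 0 < ∏ j, A j := Finset.prod_pos fun j _ => hA j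
  set m := ∑ j, n j + d with hmdef
  refine ⟨(∏ j, A j) * (m.factorial * Real.exp 2), by positivity, fun x u hu τ hτ hτ1 => ?_⟩
  obtain ⟨σ, hσ, rfl⟩ : ∃ σ : ℝ, 0 < σ ∧ τ = σ ^ 2 :=
    ⟨√τ, Real.sqrt_pos.mpr hτ, (Real.sq_sqrt hτ.le).symm⟩
  rw [Real.sqrt_sq hσ.le]
  have hσ1 : σ ≤ 1 := by nlinarith
  have hgauss : |gaussD d (σ ^ 2) u| ≤ (σ⁻¹) ^ d * Real.exp (-‖u‖ ^ 2 / (2 * σ ^ 2)) := by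
    rw [abs_of_nonneg (by unfold gaussD; positivity)]
    exact gaussD_le d hσ u
  have hprod : |∏ j : Fin d, H (n j) (x j / σ) * H (n j) (u j / σ)| ≤
      (∏ j, A j) * (Real.exp (∑ j, |x j|) * Real.exp (‖u‖ ^ 2 / (4 * σ ^ 2)) *
        (σ⁻¹) ^ (∑ j, n j)) := by
    rw [Finset.abs_prod]
    refine (Finset.prod_le_prod (fun _ _ => abs_nonneg _)
      fun j _ => hH j (x j) (u j) σ hσ hσ1).trans_eq ?_
    rw [Finset.prod_mul_distrib, Finset.prod_mul_distrib, Finset.prod_mul_distrib,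
      Finset.prod_pow_eq_pow_sum, ← Real.exp_sum, ← Real.exp_sum, ← Finset.sum_div,
      EuclideanSpace.real_norm_sq_eq]
  rw [abs_mul]
  refine (mul_le_mul hprod hgauss (abs_nonneg _) (by positivity)).trans ?_
  have hexp : Real.exp (‖u‖ ^ 2 / (4 * σ ^ 2)) * Real.exp (-‖u‖ ^ 2 / (2 * σ ^ 2)) =
      Real.exp (-‖u‖ ^ 2 / (4 * σ ^ 2)) := by
    rw [← Real.exp_add]
    congr 1
    field_simp
    ring
  calc _ = (∏ j, A j) * Real.exp (∑ j, |x j|) *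
        ((σ⁻¹) ^ m * Real.exp (-‖u‖ ^ 2 / (4 * σ ^ 2))) := by
        rw [← hexp, hmdef, pow_add]
        ring
    _ ≤ (∏ j, A j) * Real.exp (∑ j, |x j|) * (m.factorial * Real.exp 2 * ((‖u‖ ^ m)⁻¹ *
          (1 + ‖σ ^ 2 / ‖u‖ ^ 2‖) ^ (-(3 / 2) : ℝ))) := by
        gcongr _ * ?_
        exact inv_pow_mul_exp_le hm hu hσ
    _ = _ := by ring

theorem stmt7 (d : ℕ) (hd : 2 ≤ d) (n : Fin d → ℕ) (k : ℕ) (hk : k = ∑ j, n j)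
    (h : 1 ≤ k ∨ 3 ≤ d) :
    ∃ C > (0 : ℝ), ∃ r₀ > (0 : ℝ),
      ∀ w : ℝ → EuclideanSpace ℝ (Fin d), ContinuousOn w (Set.Icc 0 1) →
        ∀ u : EuclideanSpace ℝ (Fin d), 0 < ‖u‖ → ‖u‖ ≤ r₀ →
          |∫ p in Delta2,
              (∏ j : Fin d, H (n j) ((w p.2 j - w p.1 j) / Real.sqrt (p.2 - p.1)) *
                H (n j) (u j / Real.sqrt (p.2 - p.1))) * gaussD d (p.2 - p.1) u|
            ≤ C * Real.exp (∑ i : Fin d, 2 * sSup ((fun s => |w s i|) '' Set.Icc 0 1)) /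
                ‖u‖ ^ (k + d - 2) := by
  subst hk
  obtain ⟨A, hA, hbound⟩ := exists_abs_integrand_le d n (by omega)
  set I : ℝ := ∫ x : ℝ, (1 + ‖x‖) ^ (-(3 / 2) : ℝ)
  have hI : 0 ≤ I := integral_nonneg fun x => by positivity
  refine ⟨A * (I + 1), by positivity, 1, one_pos, fun w hw u hu _ => ?_⟩
  set E := Real.exp (∑ i : Fin d, 2 * sSup ((fun s => |w s i|) '' Set.Icc 0 1))
  set m := ∑ j, n j + d with hm
  have hu2 : 0 < ‖u‖ ^ 2 := by positivity
  obtain ⟨hGint, hGle⟩ := integrableOn_Delta2_comp_sub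
    (integrable_one_add_norm_rpow.comp_div hu2.ne') (fun x => by positivity)
  rw [Measure.integral_comp_div (fun x : ℝ => (1 + ‖x‖) ^ (-(3 / 2) : ℝ)), abs_of_pos hu2,
    smul_eq_mul] at hGle
  have hdom := norm_integral_le_of_norm_le (hGint.const_mul (A * E * (‖u‖ ^ m)⁻¹))
    (f := fun p : ℝ × ℝ => (∏ j : Fin d, H (n j) ((w p.2 j - w p.1 j) / Real.sqrt (p.2 - p.1)) *
      H (n j) (u j / Real.sqrt (p.2 - p.1))) * gaussD d (p.2 - p.1) u) (by
    refine (ae_restrict_iff' measurableSet_Delta2).mpr (Filter.Eventually.of_forall ?_)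
    rintro ⟨s, t⟩ ⟨hs, hst, ht⟩
    simp only at hs hst ht ⊢
    refine (hbound (w t - w s) u hu (t - s) (by linarith) (by linarith)).trans ?_
    rw [mul_assoc A, mul_assoc A, mul_assoc E]
    gcongr
    refine Real.exp_le_exp.mpr (Finset.sum_le_sum fun i _ => ?_)
    have hwi : ContinuousOn (fun s => w s i) (Set.Icc 0 1) :=
      (EuclideanSpace.proj (𝕜 := ℝ) i).continuous.comp_continuousOn hw
    exact abs_sub_le_two_mul_sSup hwi ⟨hs, by linarith⟩ ⟨by linarith, ht⟩)
  rw [Real.norm_eq_abs, integral_const_mul] at hdom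
  have hpow : ‖u‖ ^ m = ‖u‖ ^ (m - 2) * ‖u‖ ^ 2 := by
    rw [← pow_add]
    congr 1
    omega
  calc _ ≤ A * E * (‖u‖ ^ m)⁻¹ * (‖u‖ ^ 2 * I) := hdom.trans (by gcongr)
    _ = A * I * E / ‖u‖ ^ (m - 2) := by
        rw [hpow]
        field_simp
    _ ≤ A * (I + 1) * E / ‖u‖ ^ (m - 2) := by
        gcongr
        linarith
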